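/- Let n ∈ {2,3}. There exists a positive constant C, depending only on n (in particular independent of t₁, t₂ and f), such that for all real numbers t₁ < t₂ and every time-dependent function f(·,t) on ℝⁿ for which all the quantities below are defined and finite, one has ∫_{t₁}^{t₂} ‖∇f(·,t)‖_{L^∞} dt ≤ C [ ( ∫_{t₁}^{t₂} ‖f(·,t)‖_{B¹_{∞,∞}} dt ) · log( ∫_{t₁}^{t₂} ‖∇Δf(·,t)‖_{L²} dt + e ) + 1 ]. -/

import Mathlib

open MeasureTheory Metric Real SchwartzMap
open scoped ENNReal FourierTransform

noncomputable section

/-- The Littlewood–Paley block `Δ_j f = ℱ⁻¹(φ(2⁻ʲ·) ℱf)`, realized (as in the paper) as the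
convolution `Δ_j f (x) = 2^{nj} ∫ (ℱ⁻¹φ)(2ʲy) f(x-y) dy = ∫ (ℱ⁻¹φ)(z) f(x - 2⁻ʲz) dz` for
`j ≥ 0`, with `Δ_{-1} f = (ℱ⁻¹χ) ∗ f` and `Δ_j f = 0` for `j ≤ -2`. -/
def lpBlock (n : ℕ) (χ φ : 𝓢(EuclideanSpace ℝ (Fin n), ℝ)) (j : ℤ)
    (f : EuclideanSpace ℝ (Fin n) → ℂ) : EuclideanSpace ℝ (Fin n) → ℂ :=
  if j = -1 then fun x => ∫ y, (𝓕⁻ (fun ξ => (χ ξ : ℂ)) y) * f (x - y)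
  else if 0 ≤ j then fun x => ∫ y, (𝓕⁻ (fun ξ => (φ ξ : ℂ)) y) * f (x - (2:ℝ) ^ (-j) • y)
  else 0

/-- The inhomogeneous Besov norm `‖f‖_{B^σ_{r,∞}} = sup_{j ≥ -1} 2^{jσ} ‖Δ_j f‖_{L^r}`. -/
def besovNorm (n : ℕ) (χ φ : 𝓢(EuclideanSpace ℝ (Fin n), ℝ)) (σ : ℝ) (r : ℝ≥0∞)
    (f : EuclideanSpace ℝ (Fin n) → ℂ) : ℝ≥0∞ :=
  ⨆ (j : ℤ) (_ : -1 ≤ j),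
    ENNReal.ofReal ((2:ℝ) ^ ((j : ℝ) * σ)) * eLpNorm (lpBlock n χ φ j f) r volume

/-- The Laplacian `Δf = ∑ i ∂²f/∂xᵢ²`. -/
def lap (n : ℕ) (f : EuclideanSpace ℝ (Fin n) → ℂ) : EuclideanSpace ℝ (Fin n) → ℂ :=
  fun x => ∑ i : Fin n,
    iteratedFDeriv ℝ 2 f x ![EuclideanSpace.single i 1, EuclideanSpace.single i 1]

/-- `‖f‖_{H¹} = (‖f‖_{L²}² + ‖∇f‖_{L²}²)^{1/2}`. -/
def h1Norm (n : ℕ) (f : EuclideanSpace ℝ (Fin n) → ℂ) : ℝ≥0∞ :=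
  (eLpNorm f 2 volume ^ 2 + eLpNorm (fderiv ℝ f) 2 volume ^ 2) ^ (1/2 : ℝ)

/-- `‖f‖_{H²} = (‖f‖_{H¹}² + ‖∇²f‖_{L²}²)^{1/2}`. -/
def h2Norm (n : ℕ) (f : EuclideanSpace ℝ (Fin n) → ℂ) : ℝ≥0∞ :=
  (h1Norm n f ^ 2 + eLpNorm (iteratedFDeriv ℝ 2 f) 2 volume ^ 2) ^ (1/2 : ℝ)

/-- `χ, φ` are nonnegative radial Schwartz functions supported in `{|ξ| ≤ 4/3}` and
`{3/4 ≤ |ξ| ≤ 8/3}` respectively, with `χ(ξ) + ∑_{j≥0} φ(2⁻ʲξ) = 1` for all `ξ`. -/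
def IsLPPair (n : ℕ) (χ φ : 𝓢(EuclideanSpace ℝ (Fin n), ℝ)) : Prop :=
  (∀ ξ, 0 ≤ χ ξ) ∧ (∀ ξ, 0 ≤ φ ξ) ∧
  (∀ ξ η, ‖ξ‖ = ‖η‖ → χ ξ = χ η) ∧ (∀ ξ η, ‖ξ‖ = ‖η‖ → φ ξ = φ η) ∧
  tsupport ⇑χ ⊆ closedBall 0 (4/3) ∧
  tsupport ⇑φ ⊆ {ξ : EuclideanSpace ℝ (Fin n) | 3/4 ≤ ‖ξ‖ ∧ ‖ξ‖ ≤ 8/3} ∧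
  ∀ ξ, χ ξ + ∑' j : ℕ, φ ((2:ℝ) ^ (-(j:ℤ)) • ξ) = 1

/-- Directional derivative. -/
def dd {n : ℕ} (v : EuclideanSpace ℝ (Fin n)) (f : EuclideanSpace ℝ (Fin n) → ℂ) :
    EuclideanSpace ℝ (Fin n) → ℂ := fun x => fderiv ℝ f x v

theorem dd_contDiff {n : ℕ} {k : ℕ} (v : EuclideanSpace ℝ (Fin n))
    {f : EuclideanSpace ℝ (Fin n) → ℂ} (hf : ContDiff ℝ (k + 1 : ℕ) f) :
    ContDiff ℝ (k : ℕ) (dd v f) := by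
  have : ContDiff ℝ (k : ℕ) (fderiv ℝ f) := hf.fderiv_right (by norm_cast)
  exact this.clm_apply contDiff_const

theorem dd_dd {n : ℕ} (v w : EuclideanSpace ℝ (Fin n))
    {f : EuclideanSpace ℝ (Fin n) → ℂ} (hf : ContDiff ℝ 2 f) (x : EuclideanSpace ℝ (Fin n)) :
    dd w (dd v f) x = fderiv ℝ (fderiv ℝ f) x w v := by
  have h1 : DifferentiableAt ℝ (fderiv ℝ f) x :=
    ((hf.fderiv_right (m := 1) (by norm_num)).differentiable (by norm_num)) x
  have h2 : HasFDerivAt (fun y => fderiv ℝ f y v)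
      ((ContinuousLinearMap.apply ℝ ℂ v).comp (fderiv ℝ (fderiv ℝ f) x)) x :=
    (ContinuousLinearMap.apply ℝ ℂ v).hasFDerivAt.comp x h1.hasFDerivAt
  unfold dd
  rw [h2.fderiv]
  rfl

theorem dd_comm {n : ℕ} (v w : EuclideanSpace ℝ (Fin n))
    {f : EuclideanSpace ℝ (Fin n) → ℂ} (hf : ContDiff ℝ 2 f) :
    dd w (dd v f) = dd v (dd w f) := by
  ext x
  rw [dd_dd v w hf, dd_dd w v hf]
  exact (hf.contDiffAt.isSymmSndFDerivAt (by simp)).eq w v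

theorem lap_eq_sum {n : ℕ} {f : EuclideanSpace ℝ (Fin n) → ℂ} (hf : ContDiff ℝ 2 f) :
    lap n f = fun x => ∑ i : Fin n,
      dd (EuclideanSpace.single i (1:ℝ)) (dd (EuclideanSpace.single i (1:ℝ)) f) x := by
  ext x
  unfold lap
  refine Finset.sum_congr rfl fun i _ => ?_
  rw [iteratedFDeriv_two_apply, dd_dd _ _ hf]
  simp

theorem lap_continuous {n : ℕ} {f : EuclideanSpace ℝ (Fin n) → ℂ} (hf : ContDiff ℝ 2 f) :
    Continuous (lap n f) := by
  rw [lap_eq_sum hf]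
  refine continuous_finsetSum _ fun i _ => ?_
  exact (dd_contDiff (k := 0) _ (dd_contDiff (k := 1) _ (by exact_mod_cast hf))).continuous

theorem lap_dd {n : ℕ} (v : EuclideanSpace ℝ (Fin n))
    {f : EuclideanSpace ℝ (Fin n) → ℂ} (hf : ContDiff ℝ 3 f) :
    lap n (dd v f) = dd v (lap n f) := by
  have hf2 : ContDiff ℝ 2 f := hf.of_le (by norm_num)
  have hd : ∀ w, ContDiff ℝ 2 (dd w f) := fun w => by
    have := dd_contDiff (k := 2) w (f := f) (by exact_mod_cast hf)
    exact_mod_cast this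
  rw [lap_eq_sum (hd v), lap_eq_sum hf2]
  ext x
  have hs : dd v (fun x => ∑ i : Fin n,
      dd (EuclideanSpace.single i (1:ℝ)) (dd (EuclideanSpace.single i (1:ℝ)) f) x) x
      = ∑ i : Fin n, dd v (dd (EuclideanSpace.single i (1:ℝ))
          (dd (EuclideanSpace.single i (1:ℝ)) f)) x := by
    unfold dd
    rw [fderiv_fun_sum]
    · simp
    · intro i _
      have := dd_contDiff (k := 1) (EuclideanSpace.single i (1:ℝ))
        (f := dd (EuclideanSpace.single i (1:ℝ)) f) (by exact_mod_cast hd _)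
      exact (this.differentiable (by norm_num)) x
  rw [hs]
  refine Finset.sum_congr rfl fun i _ => ?_
  rw [dd_comm v _ hf2, dd_comm (EuclideanSpace.single i (1:ℝ)) v (hd _)]

theorem dd_comp_affine {n : ℕ} (v : EuclideanSpace ℝ (Fin n))
    {f : EuclideanSpace ℝ (Fin n) → ℂ} (hf : Differentiable ℝ f) (c : ℝ)
    (x : EuclideanSpace ℝ (Fin n)) :
    dd v (fun y => f (x - c • y)) = fun y => ((-c : ℝ) : ℂ) * dd v f (x - c • y) := by
  ext y
  have h1 : HasFDerivAt (fun y : EuclideanSpace ℝ (Fin n) => x - c • y)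
      (-(c • ContinuousLinearMap.id ℝ (EuclideanSpace ℝ (Fin n)))) y :=
    (((hasFDerivAt_id y).const_smul c).const_sub x)
  have h2 := (hf (x - c • y)).hasFDerivAt.comp y h1
  unfold dd
  have h3 : (fun y => f (x - c • y)) = f ∘ (fun y => x - c • y) := rfl
  rw [h3, h2.fderiv]
  simp

theorem lap_comp_affine {n : ℕ}
    {f : EuclideanSpace ℝ (Fin n) → ℂ} (hf : ContDiff ℝ 2 f) (c : ℝ)
    (x : EuclideanSpace ℝ (Fin n)) :
    lap n (fun y => f (x - c • y)) = fun y => ((c ^ 2 : ℝ) : ℂ) * lap n f (x - c • y) := by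
  have hg : ContDiff ℝ 2 (fun y => f (x - c • y)) :=
    hf.comp (contDiff_const.sub (contDiff_id.const_smul c))
  rw [lap_eq_sum hg, lap_eq_sum hf]
  ext y
  rw [Finset.mul_sum]
  refine Finset.sum_congr rfl fun i _ => ?_
  have hd : ContDiff ℝ 1 (dd (EuclideanSpace.single i (1:ℝ)) f) := by
    have := dd_contDiff (k := 1) (EuclideanSpace.single i (1:ℝ)) (f := f) (by exact_mod_cast hf)
    exact_mod_cast this
  rw [dd_comp_affine _ (hf.differentiable (by norm_num))]
  have hdd := dd_comp_affine (EuclideanSpace.single i (1:ℝ)) (hd.differentiable (by norm_num)) c x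
  have h1 : dd (EuclideanSpace.single i (1:ℝ))
      (fun y => ((-c : ℝ) : ℂ) * dd (EuclideanSpace.single i (1:ℝ)) f (x - c • y)) y
      = ((-c : ℝ) : ℂ) * dd (EuclideanSpace.single i (1:ℝ))
        (fun y => dd (EuclideanSpace.single i (1:ℝ)) f (x - c • y)) y := by
    unfold dd
    rw [fderiv_const_mul]
    · simp
    · have : ContDiff ℝ 1 (fun y => dd (EuclideanSpace.single i (1:ℝ)) f (x - c • y)) :=
        hd.comp (contDiff_const.sub (contDiff_id.const_smul c))
      exact (this.differentiable (by norm_num)) y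
  rw [h1, hdd]
  push_cast
  ring

theorem ibp_compact_dd {n : ℕ} (v : EuclideanSpace ℝ (Fin n))
    {w u : EuclideanSpace ℝ (Fin n) → ℂ} (hw : ContDiff ℝ 1 w) (hu : ContDiff ℝ 1 u)
    (hc : HasCompactSupport w) :
    ∫ y, w y * dd v u y = - ∫ y, dd v w y * u y := by
  have hw' : Continuous (dd v w) := (dd_contDiff (k := 0) v (by exact_mod_cast hw)).continuous
  have hu' : Continuous (dd v u) := (dd_contDiff (k := 0) v (by exact_mod_cast hu)).continuous
  have hcw' : HasCompactSupport (dd v w) := hc.fderiv_apply (𝕜 := ℝ) v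
  refine integral_mul_fderiv_eq_neg_fderiv_mul_of_integrable ?_ ?_ ?_ ?_ ?_
  · exact (hw'.mul hu.continuous).integrable_of_hasCompactSupport hcw'.mul_right
  · exact (hw.continuous.mul hu').integrable_of_hasCompactSupport hc.mul_right
  · exact (hw.continuous.mul hu.continuous).integrable_of_hasCompactSupport hc.mul_right
  · exact fun x _ => (hw.differentiable (by norm_num)) x
  · exact fun x _ => (hu.differentiable (by norm_num)) x

theorem ibp_compact_lap {n : ℕ}
    {w u : EuclideanSpace ℝ (Fin n) → ℂ} (hw : ContDiff ℝ 2 w) (hu : ContDiff ℝ 2 u)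
    (hc : HasCompactSupport w) :
    ∫ y, lap n w y * u y = ∫ y, w y * lap n u y := by
  have d1 : ∀ {g : EuclideanSpace ℝ (Fin n) → ℂ} (v), ContDiff ℝ 2 g → ContDiff ℝ 1 (dd v g) := by
    intro g v hg
    have := dd_contDiff (k := 1) v (f := g) (by exact_mod_cast hg)
    exact_mod_cast this
  have d0 : ∀ {g : EuclideanSpace ℝ (Fin n) → ℂ} (v), ContDiff ℝ 1 g → Continuous (dd v g) := by
    intro g v hg
    exact (dd_contDiff (k := 0) v (f := g) (by exact_mod_cast hg)).continuous
  rw [lap_eq_sum hw, lap_eq_sum hu]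
  simp_rw [Finset.sum_mul, Finset.mul_sum]
  have hw1 : ContDiff ℝ 1 w := hw.of_le (by norm_num)
  have hu1 : ContDiff ℝ 1 u := hu.of_le (by norm_num)
  have c1 : ∀ v, HasCompactSupport (dd v w) := fun v => hc.fderiv_apply (𝕜 := ℝ) v
  have c2 : ∀ v, HasCompactSupport (dd v (dd v w)) := fun v => (c1 v).fderiv_apply (𝕜 := ℝ) v
  rw [integral_finsetSum, integral_finsetSum]
  · refine Finset.sum_congr rfl fun i _ => ?_
    rw [ibp_compact_dd _ hw1 (d1 _ hu) hc, ibp_compact_dd _ (d1 _ hw) hu1 (c1 _), neg_neg]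
  · intro i _
    exact (hw.continuous.mul (d0 _ (d1 _ hu))).integrable_of_hasCompactSupport hc.mul_right
  · intro i _
    exact ((d0 _ (d1 _ hw)).mul hu.continuous).integrable_of_hasCompactSupport (c2 _).mul_right

theorem norm_lap_le {n : ℕ} (f : EuclideanSpace ℝ (Fin n) → ℂ) (x : EuclideanSpace ℝ (Fin n)) :
    ‖lap n f x‖ ≤ n * ‖iteratedFDeriv ℝ 2 f x‖ := by
  unfold lap
  refine (norm_sum_le _ _).trans ?_
  refine (Finset.sum_le_card_nsmul _ _ (‖iteratedFDeriv ℝ 2 f x‖) fun i _ => ?_).trans (by simp)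
  refine (ContinuousMultilinearMap.le_opNorm _ _).trans ?_
  simp [Fin.prod_univ_two]

theorem ibp_lap {n : ℕ} (m : 𝓢(EuclideanSpace ℝ (Fin n), ℂ))
    {u : EuclideanSpace ℝ (Fin n) → ℂ} (hu : ContDiff ℝ 2 u) (A : ℝ) (hA : ∀ x, ‖u x‖ ≤ A)
    (hint : Integrable (fun y => m y * lap n u y)) :
    ∫ y, lap n m y * u y = ∫ y, m y * lap n u y := by
  classical
  let b : ContDiffBump (0 : EuclideanSpace ℝ (Fin n)) := ⟨1, 2, by norm_num, by norm_num⟩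
  have hA0 : 0 ≤ A := (norm_nonneg _).trans (hA 0)
  let ρ : 𝓢(EuclideanSpace ℝ (Fin n), ℝ) := b.hasCompactSupport.toSchwartzMap b.contDiff
  have hρ : ∀ x, ρ x = b x := fun x => rfl
  have hm2 : ContDiff ℝ 2 m := m.smooth 2
  let c : ℕ → ℝ := fun R => ((R : ℝ) + 1)⁻¹
  have hc0 : ∀ R, 0 < c R := fun R => by positivity
  have hc1 : ∀ R, c R ≤ 1 := fun R => by
    apply inv_le_one_of_one_le₀; simp
  let r : ℕ → EuclideanSpace ℝ (Fin n) → ℝ := fun R y => ρ (c R • y)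
  have hr : ∀ R, ContDiff ℝ 2 (r R) := fun R =>
    (ρ.smooth 2).comp (contDiff_id.const_smul (c R))
  let w : ℕ → EuclideanSpace ℝ (Fin n) → ℂ := fun R y => r R y • m y
  have hw : ∀ R, ContDiff ℝ 2 (w R) := fun R => (hr R).smul hm2
  have hrc : ∀ R, HasCompactSupport (r R) := fun R =>
    b.hasCompactSupport.comp_smul (hc0 R).ne'
  have hwc : ∀ R, HasCompactSupport (w R) := fun R => (hrc R).smul_right
  have key : ∀ R, ∫ y, lap n (w R) y * u y = ∫ y, w R y * lap n u y := fun R =>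
    ibp_compact_lap (hw R) hu (hwc R)
  -- pointwise eventual equality
  have hev : ∀ y, ∀ᶠ R in Filter.atTop, w R =ᶠ[nhds y] m := by
    intro y
    obtain ⟨N, hN⟩ := exists_nat_gt ‖y‖
    filter_upwards [Filter.eventually_ge_atTop N] with R hR
    have : ∀ᶠ z in nhds y, ‖z‖ < N := (isOpen_lt continuous_norm continuous_const).mem_nhds hN
    filter_upwards [this] with z hz
    have h1 : r R z = 1 := by
      apply b.one_of_mem_closedBall
      rw [mem_closedBall_zero_iff, norm_smul, Real.norm_of_nonneg (hc0 R).le]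
      change ((R : ℝ) + 1)⁻¹ * ‖z‖ ≤ 1
      rw [inv_mul_le_iff₀ (by positivity)]
      have : (N : ℝ) ≤ R := by exact_mod_cast hR
      linarith
    simp [w, h1]
  have hrle : ∀ R y, |r R y| ≤ 1 := fun R y => by
    change |b (c R • y)| ≤ 1
    rw [abs_of_nonneg (b.nonneg)]; exact b.le_one
  -- limits
  have lim2 : Filter.Tendsto (fun R => ∫ y, w R y * lap n u y) Filter.atTop
      (nhds (∫ y, m y * lap n u y)) := by
    refine tendsto_integral_of_dominated_convergence (fun y => ‖m y * lap n u y‖) ?_ hint.norm ?_ ?_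
    · intro R
      exact ((hw R).continuous.mul (lap_continuous hu)).aestronglyMeasurable
    · intro R
      refine Filter.Eventually.of_forall fun y => ?_
      simp only [w, norm_mul, norm_smul, Real.norm_eq_abs]
      have := hrle R y
      have h0 : 0 ≤ ‖m y‖ * ‖lap n u y‖ := by positivity
      nlinarith
    · refine Filter.Eventually.of_forall fun y => ?_
      refine tendsto_const_nhds.congr' ?_
      filter_upwards [hev y] with R hR
      rw [hR.eq_of_nhds]
  obtain ⟨M, hM0, hM⟩ : ∃ M : ℝ, 0 ≤ M ∧ ∀ i ≤ 2, ∀ R y, ‖iteratedFDeriv ℝ i (r R) y‖ ≤ M := by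
    refine ⟨∑ i ∈ Finset.range 3, SchwartzMap.seminorm ℝ 0 i ρ,
      Finset.sum_nonneg fun i _ => apply_nonneg _ _, fun i hi R y => ?_⟩
    have h1 : iteratedFDeriv ℝ i (r R) y = (c R) ^ i • iteratedFDeriv ℝ i ρ (c R • y) := by
      have := iteratedFDeriv_comp_const_smul (i := i) (c R) (ρ.smooth i)
      exact congrFun this y
    rw [h1, norm_smul]
    have h2 := SchwartzMap.norm_iteratedFDeriv_le_seminorm ℝ ρ i (c R • y)
    have h3 : ‖(c R) ^ i‖ ≤ 1 := by
      rw [norm_pow, Real.norm_of_nonneg (hc0 R).le]; exact pow_le_one₀ (hc0 R).le (hc1 R)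
    have h4 : SchwartzMap.seminorm ℝ 0 i ρ ≤ ∑ i ∈ Finset.range 3, SchwartzMap.seminorm ℝ 0 i ρ :=
      Finset.single_le_sum (f := fun i => SchwartzMap.seminorm ℝ 0 i ρ)
        (fun i _ => apply_nonneg _ _) (by simp; omega)
    calc _ ≤ 1 * ‖iteratedFDeriv ℝ i ρ (c R • y)‖ := by gcongr
      _ ≤ _ := by rw [one_mul]; exact h2.trans h4
  have lim1 : Filter.Tendsto (fun R => ∫ y, lap n (w R) y * u y) Filter.atTop
      (nhds (∫ y, lap n m y * u y)) := by
    refine tendsto_integral_of_dominated_convergence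
      (fun y => n * (∑ i ∈ Finset.range 3, (Nat.choose 2 i : ℝ) * M *
        ‖iteratedFDeriv ℝ (2 - i) m y‖) * A) ?_ ?_ ?_ ?_
    · intro R
      exact ((lap_continuous (hw R)).mul hu.continuous).aestronglyMeasurable
    · refine ((integrable_finsetSum _ fun i _ => ?_).const_mul _).mul_const _
      refine Integrable.const_mul ?_ _
      simpa using m.integrable_pow_mul_iteratedFDeriv volume 0 (2 - i)
    · intro R
      refine Filter.Eventually.of_forall fun y => ?_
      rw [norm_mul]
      refine mul_le_mul ?_ (hA y) (norm_nonneg _) (by positivity)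
      refine (norm_lap_le _ _).trans ?_
      gcongr
      refine (norm_iteratedFDeriv_smul_le (hr R) hm2 y (n := 2) le_rfl).trans ?_
      refine Finset.sum_le_sum fun i hi => ?_
      gcongr
      exact hM i (by simp at hi; omega) R y
    · refine Filter.Eventually.of_forall fun y => ?_
      refine tendsto_const_nhds.congr' ?_
      filter_upwards [hev y] with R hR
      have : lap n (w R) y = lap n m y := by
        unfold lap
        rw [(hR.iteratedFDeriv ℝ 2).eq_of_nhds]
      rw [this]
  simp_rw [key] at lim1
  exact tendsto_nhds_unique lim1 lim2

/-- Scaled convolution. -/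
def TT {n : ℕ} (k : EuclideanSpace ℝ (Fin n) → ℂ) (c : ℝ) (f : EuclideanSpace ℝ (Fin n) → ℂ)
    (x : EuclideanSpace ℝ (Fin n)) : ℂ := ∫ y, k y * f (x - c • y)

theorem map_affine {n : ℕ} {c : ℝ} (hc : 0 < c) (x : EuclideanSpace ℝ (Fin n)) :
    Measure.map (fun y : EuclideanSpace ℝ (Fin n) => x - c • y) volume
      = ENNReal.ofReal ((c ^ n)⁻¹) • (volume : Measure (EuclideanSpace ℝ (Fin n))) := by
  have h1 : (fun y : EuclideanSpace ℝ (Fin n) => x - c • y) = (fun y => x - y) ∘ (fun y => c • y) :=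
    rfl
  rw [h1, ← Measure.map_map (by fun_prop) (by fun_prop), Measure.map_addHaar_smul _ hc.ne',
    Measure.map_smul,
    ((volume : Measure (EuclideanSpace ℝ (Fin n))).measurePreserving_sub_left x).map_eq]
  simp only [finrank_euclideanSpace, Fintype.card_fin]
  rw [abs_of_pos (by positivity)]

theorem ae_affine {n : ℕ} {c : ℝ} (hc : 0 < c) (x : EuclideanSpace ℝ (Fin n))
    {p : EuclideanSpace ℝ (Fin n) → Prop} (hp : ∀ᵐ y, p y) : ∀ᵐ y, p (x - c • y) := by
  have h : Filter.Tendsto (fun y : EuclideanSpace ℝ (Fin n) => x - c • y)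
      (ae volume) (ae volume) := by
    refine (Measure.QuasiMeasurePreserving.tendsto_ae ⟨by fun_prop, ?_⟩)
    rw [map_affine hc]
    exact Measure.smul_absolutelyContinuous
  exact h.eventually hp

theorem eLpNorm_affine {n : ℕ} {c : ℝ} (hc : 0 < c) (x : EuclideanSpace ℝ (Fin n))
    {W : EuclideanSpace ℝ (Fin n) → ℂ} (hW : Continuous W) :
    eLpNorm (fun y => W (x - c • y)) 2 volume
      = ENNReal.ofReal (c ^ (-(n : ℝ) / 2)) * eLpNorm W 2 volume := by
  have h1 : (fun y => W (x - c • y)) = W ∘ (fun y => x - c • y) := rfl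
  rw [h1, ← eLpNorm_map_measure hW.aestronglyMeasurable (by fun_prop), map_affine hc,
    eLpNorm_smul_measure_of_ne_top (by simp), smul_eq_mul,
    ENNReal.ofReal_rpow_of_pos (by positivity)]
  congr 2
  rw [← Real.rpow_natCast, ← Real.rpow_neg hc.le, ← Real.rpow_mul hc.le]
  congr 1
  simp
  ring

theorem holder_two {n : ℕ} {a b : EuclideanSpace ℝ (Fin n) → ℂ}
    (ha : MemLp a 2 volume) (hb : MemLp b 2 volume) :
    ‖∫ y, a y * b y‖ ≤ (eLpNorm a 2 volume).toReal * (eLpNorm b 2 volume).toReal := by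
  have h := eLpNorm_smul_le_mul_eLpNorm (p := 2) (q := 2) (r := 1) hb.1 ha.1
  rw [eLpNorm_one_eq_lintegral_enorm] at h
  have h2 := (enorm_integral_le_lintegral_enorm (fun y => a y * b y)).trans h
  rw [← ENNReal.toReal_mul, ← toReal_enorm]
  exact ENNReal.toReal_mono (ENNReal.mul_ne_top ha.eLpNorm_ne_top hb.eLpNorm_ne_top) h2

theorem high_est {n : ℕ} (m : 𝓢(EuclideanSpace ℝ (Fin n), ℂ))
    {u : EuclideanSpace ℝ (Fin n) → ℂ} (hu : ContDiff ℝ 2 u) (A : ℝ) (hA : ∀ x, ‖u x‖ ≤ A)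
    (hL : eLpNorm (lap n u) 2 volume ≠ ⊤) {c : ℝ} (hc : 0 < c) (x : EuclideanSpace ℝ (Fin n)) :
    ‖TT (lap n m) c u x‖ ≤ c ^ (2 - (n : ℝ) / 2) *
      ((eLpNorm m 2 volume).toReal * (eLpNorm (lap n u) 2 volume).toReal) := by
  have hlc := lap_continuous hu
  have hm : MemLp m 2 volume := m.memLp 2
  have hW : MemLp (fun y => lap n u (x - c • y)) 2 volume := by
    refine ⟨(hlc.comp (by fun_prop)).aestronglyMeasurable, ?_⟩
    rw [eLpNorm_affine hc x hlc]
    exact ENNReal.mul_lt_top (by simp) (lt_top_iff_ne_top.2 hL)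
  have hu' : ContDiff ℝ 2 (fun y => u (x - c • y)) :=
    hu.comp (contDiff_const.sub (contDiff_id.const_smul c))
  have hi : Integrable (fun y => m y * lap n u (x - c • y)) := hm.integrable_mul hW
  have e1 : TT (lap n m) c u x = ((c ^ 2 : ℝ) : ℂ) * ∫ y, m y * lap n u (x - c • y) := by
    unfold TT
    rw [ibp_lap m hu' A (fun y => hA _)]
    · rw [lap_comp_affine hu, ← integral_const_mul]
      congr 1; ext y; ring
    · rw [lap_comp_affine hu]
      refine (hi.const_mul ((c ^ 2 : ℝ) : ℂ)).congr (Filter.Eventually.of_forall fun y => ?_)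
      simp only []; ring
  have h2 := holder_two hm hW
  rw [eLpNorm_affine hc x hlc, ENNReal.toReal_mul, ENNReal.toReal_ofReal (by positivity)] at h2
  rw [e1, norm_mul, Complex.norm_real, Real.norm_of_nonneg (by positivity)]
  have e3 : c ^ (2 - (n : ℝ) / 2) = c ^ 2 * c ^ (-(n : ℝ) / 2) := by
    rw [← Real.rpow_natCast, ← Real.rpow_add hc]; congr 1; push_cast; ring
  rw [e3]
  calc _ ≤ c ^ 2 * ((eLpNorm m 2 volume).toReal * (c ^ (-(n:ℝ) / 2) * (eLpNorm (lap n u) 2 volume).toReal)) := by gcongr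
    _ = _ := by ring

theorem integrable_growth {n : ℕ} (k : 𝓢(EuclideanSpace ℝ (Fin n), ℂ))
    {F : EuclideanSpace ℝ (Fin n) → ℂ} (hF : Continuous F) {A : ℝ}
    (hA : ∀ y, ‖F y‖ ≤ A * (1 + ‖y‖)) : Integrable (fun y => k y * F y) := by
  have h1 : Integrable (fun y => A * (‖k y‖ + ‖y‖ ^ 1 * ‖k y‖)) :=
    (k.integrable.norm.add (k.integrable_pow_mul volume 1)).const_mul A
  refine h1.mono' (k.continuous.mul hF).aestronglyMeasurable (Filter.Eventually.of_forall fun y => ?_)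
  rw [norm_mul]
  calc _ ≤ ‖k y‖ * (A * (1 + ‖y‖)) := by gcongr; exact hA y
    _ = _ := by ring

theorem integrable_one_add {n : ℕ} (k : 𝓢(EuclideanSpace ℝ (Fin n), ℂ)) :
    Integrable (fun y => ‖k y‖ * (1 + ‖y‖)) := by
  refine (k.integrable.norm.add (k.integrable_pow_mul volume 1)).congr
    (Filter.Eventually.of_forall fun y => ?_)
  simp; ring

theorem bernstein_core {n : ℕ} (v : EuclideanSpace ℝ (Fin n))
    (k K k' : 𝓢(EuclideanSpace ℝ (Fin n), ℂ)) (hk' : ∀ y, k' y = dd v k y)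
    (hK : ∀ y, k' y = ∫ z, K z * k (y - z))
    {F : EuclideanSpace ℝ (Fin n) → ℂ} (hF : ContDiff ℝ 1 F) {A L : ℝ}
    (hA : ∀ y, ‖F y‖ ≤ A * (1 + ‖y‖)) (hL : ∀ y, ‖dd v F y‖ ≤ L) :
    ∫ y, k y * dd v F y = - ∫ z, K z * ∫ y, k y * F (y + z) := by
  have hdF : Continuous (dd v F) := (dd_contDiff (k := 0) v (by exact_mod_cast hF)).continuous
  have hL0 : 0 ≤ L := (norm_nonneg _).trans (hL 0)
  have hA0 : 0 ≤ A := by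
    have := (norm_nonneg _).trans (hA 0)
    simpa using this
  have hk'e : (fun y => fderiv ℝ k y v) = k' := by ext y; rw [hk' y]; rfl
  have s1 : ∫ y, k y * dd v F y = - ∫ y, k' y * F y := by
    simp_rw [hk']
    refine integral_mul_fderiv_eq_neg_fderiv_mul_of_integrable ?_ ?_ ?_ ?_ ?_
    · have := integrable_growth k' hF.continuous hA
      simp_rw [hk'] at this
      exact this
    · refine integrable_growth k hdF (A := L) fun y => (hL y).trans ?_
      nlinarith [norm_nonneg y]
    · exact integrable_growth k hF.continuous hA
    · exact fun x _ => k.differentiableAt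
    · exact fun x _ => (hF.differentiable (by norm_num)) x
  rw [s1]
  congr 1
  have s2 : ∫ y, k' y * F y = ∫ y, ∫ z, K z * k (y - z) * F y := by
    congr 1; ext y
    rw [hK y, ← integral_mul_const]
  rw [s2, integral_integral_swap]
  · congr 1; ext z
    rw [← integral_const_mul, ← integral_add_right_eq_self _ z]
    congr 1; ext y
    simp [mul_assoc]
  · have hb := (integrable_one_add K).convolution_integrand (ContinuousLinearMap.mul ℝ ℝ)
      (integrable_one_add k)
    refine (hb.const_mul A).mono' ?_ (Filter.Eventually.of_forall ?_)
    · refine Continuous.aestronglyMeasurable ?_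
      have := K.continuous
      have := k.continuous
      have := hF.continuous
      simp only [Function.uncurry_def]
      fun_prop
    · rintro ⟨y, z⟩
      simp only [Function.uncurry_apply_pair, norm_mul, ContinuousLinearMap.mul_apply']
      have h1 : ‖F y‖ ≤ A * ((1 + ‖z‖) * (1 + ‖y - z‖)) := by
        refine (hA y).trans ?_
        gcongr
        have : ‖y‖ ≤ ‖y - z‖ + ‖z‖ := by simpa using norm_add_le (y - z) z
        nlinarith [norm_nonneg z, norm_nonneg (y - z)]
      calc _ ≤ ‖K z‖ * ‖k (y - z)‖ * (A * ((1 + ‖z‖) * (1 + ‖y - z‖))) := by gcongr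
        _ = _ := by ring

theorem bernstein_est {n : ℕ} (v : EuclideanSpace ℝ (Fin n))
    (k K k' : 𝓢(EuclideanSpace ℝ (Fin n), ℂ)) (hk' : ∀ y, k' y = dd v k y)
    (hK : ∀ y, k' y = ∫ z, K z * k (y - z))
    {f : EuclideanSpace ℝ (Fin n) → ℂ} (hf : ContDiff ℝ 1 f) {L : ℝ}
    (hL : ∀ y, ‖fderiv ℝ f y‖ ≤ L) {c : ℝ} (hc : 0 < c) {S : ℝ}
    (hS : ∀ᵐ y, ‖TT k c f y‖ ≤ S) (x : EuclideanSpace ℝ (Fin n)) :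
    ‖TT k c (dd v f) x‖ ≤ c⁻¹ * ((∫ z, ‖K z‖) * S) := by
  have hfd : Differentiable ℝ f := hf.differentiable (by norm_num)
  have hL0 : 0 ≤ L := (norm_nonneg _).trans (hL 0)
  have hF : ContDiff ℝ 1 (fun y => f (x - c • y)) :=
    hf.comp (contDiff_const.sub (contDiff_id.const_smul c))
  have hlip : ∀ a b, ‖f a - f b‖ ≤ L * ‖a - b‖ := fun a b =>
    Convex.norm_image_sub_le_of_norm_fderiv_le (𝕜 := ℝ) (fun z _ => hfd z) (fun z _ => hL z)
      convex_univ (Set.mem_univ b) (Set.mem_univ a)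
  have hA : ∀ y, ‖f (x - c • y)‖ ≤ (‖f x‖ + L * c) * (1 + ‖y‖) := fun y => by
    have h1 := hlip (x - c • y) x
    have h2 : ‖x - c • y - x‖ = c * ‖y‖ := by
      rw [sub_sub_cancel_left, norm_neg, norm_smul, Real.norm_of_nonneg hc.le]
    rw [h2] at h1
    have h3 : ‖f (x - c • y)‖ ≤ ‖f (x - c • y) - f x‖ + ‖f x‖ := by
      simpa using norm_add_le (f (x - c • y) - f x) (f x)
    have h4 := mul_nonneg (norm_nonneg (f x)) (norm_nonneg y)
    have h5 := mul_nonneg hL0 hc.le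
    nlinarith
  have hLd : ∀ y, ‖dd v (fun y => f (x - c • y)) y‖ ≤ c * (L * ‖v‖) := fun y => by
    rw [dd_comp_affine v hfd]
    simp only [norm_mul, Complex.norm_real, norm_neg, Real.norm_of_nonneg hc.le]
    gcongr
    exact (ContinuousLinearMap.le_opNorm _ _).trans (by gcongr; exact hL _)
  have hb := bernstein_core v k K k' hk' hK hF hA hLd
  rw [dd_comp_affine v hfd] at hb
  have e1 : ∫ y, k y * (((-c : ℝ) : ℂ) * dd v f (x - c • y)) = -(c : ℂ) * TT k c (dd v f) x := by
    unfold TT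
    rw [← integral_const_mul]
    congr 1; ext y; push_cast; ring
  have e2 : ∀ z, ∫ y, k y * f (x - c • (y + z)) = TT k c f (x - c • z) := fun z => by
    unfold TT
    congr 1; ext y
    congr 2
    rw [smul_add]; abel
  simp_rw [e2] at hb
  rw [e1] at hb
  have hb2 : (c : ℂ) * TT k c (dd v f) x = ∫ z, K z * TT k c f (x - c • z) := by
    have := congrArg Neg.neg hb
    simpa using this
  have hb3 : ‖∫ z, K z * TT k c f (x - c • z)‖ ≤ (∫ z, ‖K z‖) * S := by
    rw [← integral_mul_const]
    refine norm_integral_le_of_norm_le (K.integrable.norm.mul_const S) ?_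
    filter_upwards [ae_affine hc x hS] with z hz
    rw [norm_mul]
    gcongr
  rw [← hb2, norm_mul, Complex.norm_real, Real.norm_of_nonneg hc.le] at hb3
  rw [← div_eq_inv_mul, le_div_iff₀ hc, mul_comm]
  exact hb3

theorem lp_half {n : ℕ} {χ φ : 𝓢(EuclideanSpace ℝ (Fin n), ℝ)} (h : IsLPPair n χ φ)
    (ξ : EuclideanSpace ℝ (Fin n)) : χ ((2:ℝ)⁻¹ • ξ) = χ ξ + φ ξ := by
  obtain ⟨-, -, -, -, -, hφ, hs⟩ := h
  have hz : ∀ η : EuclideanSpace ℝ (Fin n), ‖η‖ < 3/4 → φ η = 0 := fun η hη => by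
    by_contra hne
    have := (hφ (subset_tsupport _ hne)).1
    linarith
  have hsum : Summable (fun j : ℕ => φ ((2:ℝ) ^ (-(j:ℤ)) • ξ)) := by
    obtain ⟨N, hN⟩ : ∃ N : ℕ, ‖ξ‖ * (1/2:ℝ) ^ N < 3/4 := by
      have : Filter.Tendsto (fun N : ℕ => ‖ξ‖ * (1/2:ℝ) ^ N) Filter.atTop (nhds (‖ξ‖ * 0)) :=
        (tendsto_pow_atTop_nhds_zero_of_lt_one (by norm_num) (by norm_num)).const_mul _
      rw [mul_zero] at this
      exact (this.eventually (gt_mem_nhds (by norm_num))).exists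
    refine summable_of_ne_finset_zero (s := Finset.range N) fun j hj => hz _ ?_
    rw [norm_smul, Real.norm_of_nonneg (by positivity), zpow_neg, zpow_natCast, ← inv_pow]
    refine lt_of_le_of_lt ?_ hN
    rw [mul_comm, one_div]
    gcongr ‖ξ‖ * ?_
    exact pow_le_pow_of_le_one (by norm_num) (by norm_num) (by simpa using hj)
  have h1 := hs ξ
  have h2 := hs ((2:ℝ)⁻¹ • ξ)
  rw [hsum.tsum_eq_zero_add] at h1
  have h3 : ∀ j : ℕ, φ ((2:ℝ) ^ (-(j:ℤ)) • (2:ℝ)⁻¹ • ξ) = φ ((2:ℝ) ^ (-((j + 1 : ℕ):ℤ)) • ξ) := by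
    intro j
    rw [smul_smul]
    congr 2
    rw [zpow_neg, zpow_neg, zpow_natCast, zpow_natCast, pow_succ, mul_inv]
  simp_rw [h3] at h2
  simp only [Nat.cast_zero, neg_zero, zpow_zero, one_smul] at h1
  linarith

theorem lp_zero {n : ℕ} {χ φ : 𝓢(EuclideanSpace ℝ (Fin n), ℝ)} (h : IsLPPair n χ φ) :
    χ 0 = 1 := by
  obtain ⟨-, -, -, -, -, hφ, hs⟩ := h
  have hz : φ 0 = 0 := by
    by_contra hne
    have := (hφ (subset_tsupport _ hne)).1
    norm_num at this
  have := hs 0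
  simpa [hz] using this

/-- Complexification of a real Schwartz function. -/
def toC {n : ℕ} (χ : 𝓢(EuclideanSpace ℝ (Fin n), ℝ)) : 𝓢(EuclideanSpace ℝ (Fin n), ℂ) :=
  χ.postcompCLM Complex.ofRealCLM

theorem toC_apply {n : ℕ} (χ : 𝓢(EuclideanSpace ℝ (Fin n), ℝ)) (x : EuclideanSpace ℝ (Fin n)) :
    toC χ x = (χ x : ℂ) := rfl

/-- Kernel. -/
def ker {n : ℕ} (χ : 𝓢(EuclideanSpace ℝ (Fin n), ℝ)) : 𝓢(EuclideanSpace ℝ (Fin n), ℂ) :=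
  𝓕⁻ (toC χ)

theorem ker_apply {n : ℕ} (χ : 𝓢(EuclideanSpace ℝ (Fin n), ℝ)) (y : EuclideanSpace ℝ (Fin n)) :
    𝓕⁻ (fun ξ => (χ ξ : ℂ)) y = ker χ y := by
  unfold ker
  rw [SchwartzMap.fourierInv_coe]
  rfl

open LineDeriv in
theorem exists_bernstein_kernel {n : ℕ} (v : EuclideanSpace ℝ (Fin n))
    (μ : 𝓢(EuclideanSpace ℝ (Fin n), ℂ)) (hμ : ∀ ξ, μ ξ ≠ 0 → ‖ξ‖ ≤ 8/3) :
    ∃ K k' : 𝓢(EuclideanSpace ℝ (Fin n), ℂ), (∀ y, k' y = dd v (𝓕⁻ μ : 𝓢(EuclideanSpace ℝ (Fin n), ℂ)) y) ∧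
      ∀ y, k' y = ∫ z, K z * (𝓕⁻ μ : 𝓢(EuclideanSpace ℝ (Fin n), ℂ)) (y - z) := by
  let b : ContDiffBump (0 : EuclideanSpace ℝ (Fin n)) := ⟨8/3, 3, by norm_num, by norm_num⟩
  let ψ : 𝓢(EuclideanSpace ℝ (Fin n), ℂ) := toC (b.hasCompactSupport.toSchwartzMap b.contDiff)
  have hψ : ∀ ξ, ψ ξ * μ ξ = μ ξ := by
    intro ξ
    by_cases h : μ ξ = 0
    · simp [h]
    · have : b ξ = 1 := b.one_of_mem_closedBall (by
        rw [mem_closedBall_zero_iff]; exact hμ ξ h)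
      change ((b ξ : ℝ) : ℂ) * μ ξ = μ ξ
      simp [this]
  have ht : (fun x : EuclideanSpace ℝ (Fin n) => inner ℝ x v).HasTemperateGrowth := by fun_prop
  let K : 𝓢(EuclideanSpace ℝ (Fin n), ℂ) := ∂_{v} (𝓕⁻ ψ)
  let k' : 𝓢(EuclideanSpace ℝ (Fin n), ℂ) := ∂_{v} (𝓕⁻ μ)
  have hk : k' = SchwartzMap.convolution (ContinuousLinearMap.mul ℂ ℂ) K (𝓕⁻ μ) := by
    have h1 : 𝓕 k' = 𝓕 (SchwartzMap.convolution (ContinuousLinearMap.mul ℂ ℂ) K (𝓕⁻ μ)) := by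
      rw [SchwartzMap.fourier_convolution]
      simp only [k', K, SchwartzMap.lineDerivOp_fourierInv_eq, FourierTransform.fourier_fourierInv_eq]
      ext ξ
      simp only [SchwartzMap.pairing_apply_apply, _root_.smul_apply,
        SchwartzMap.smulLeftCLM_apply_apply ht, ContinuousLinearMap.mul_apply']
      rw [smul_mul_assoc, smul_mul_assoc, hψ]
    have h2 := congrArg (fun g => 𝓕⁻ g) h1
    simpa using h2
  refine ⟨K, k', fun y => ?_, fun y => ?_⟩
  · exact SchwartzMap.lineDerivOp_apply_eq_fderiv _ _ _
  · conv_lhs => rw [hk]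
    rw [SchwartzMap.convolution_apply]
    rfl

open Laplacian in
theorem lap_schwartz {n : ℕ} (m : 𝓢(EuclideanSpace ℝ (Fin n), ℂ)) (y : EuclideanSpace ℝ (Fin n)) :
    lap n m y = (Δ m) y := by
  rw [SchwartzMap.laplacian_apply,
    InnerProductSpace.laplacian_eq_iteratedFDeriv_orthonormalBasis m
      (EuclideanSpace.basisFun (Fin n) ℝ)]
  simp [lap]

open Laplacian in
theorem exists_inv_lap {n : ℕ}
    (μ : 𝓢(EuclideanSpace ℝ (Fin n), ℂ)) (hμ : ∀ ξ, μ ξ ≠ 0 → 3/4 ≤ ‖ξ‖ ∧ ‖ξ‖ ≤ 8/3) :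
    ∃ m : 𝓢(EuclideanSpace ℝ (Fin n), ℂ), ∀ y,
      lap n m y = (𝓕⁻ μ : 𝓢(EuclideanSpace ℝ (Fin n), ℂ)) y := by
  let q : EuclideanSpace ℝ (Fin n) → ℂ := fun ξ => (-((2 * π) ^ 2 * ‖ξ‖ ^ 2)⁻¹ : ℝ) • μ ξ
  have hq : ContDiff ℝ (⊤ : ℕ∞) q := by
    rw [contDiff_iff_contDiffAt]
    intro ξ
    by_cases hξ : ‖ξ‖ < 3/4
    · refine (contDiffAt_const (c := (0:ℂ))).congr_of_eventuallyEq ?_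
      have : ∀ᶠ z in nhds ξ, ‖z‖ < 3/4 :=
        (isOpen_lt continuous_norm continuous_const).mem_nhds hξ
      filter_upwards [this] with z hz
      have : μ z = 0 := by
        by_contra hne
        linarith [(hμ z hne).1]
      simp [q, this]
    · have h0 : (2 * π) ^ 2 * ‖ξ‖ ^ 2 ≠ 0 := by
        have := Real.pi_pos
        push Not at hξ
        have : 0 < ‖ξ‖ := by linarith
        positivity
      have g1 : ContDiffAt ℝ (⊤ : ℕ∞)
          (fun ξ : EuclideanSpace ℝ (Fin n) => (2 * π) ^ 2 * ‖ξ‖ ^ 2) ξ :=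
        contDiffAt_const.mul (contDiff_norm_sq ℝ).contDiffAt
      exact (g1.inv h0).neg.smul (μ.smooth ⊤).contDiffAt
  have hqc : HasCompactSupport q := by
    refine HasCompactSupport.of_support_subset_isCompact
      (isCompact_closedBall (0 : EuclideanSpace ℝ (Fin n)) (8/3)) fun ξ hξ => ?_
    rw [mem_closedBall_zero_iff]
    refine (hμ ξ fun h => hξ ?_).2
    simp [q, h]
  let ν : 𝓢(EuclideanSpace ℝ (Fin n), ℂ) := hqc.toSchwartzMap hq
  refine ⟨𝓕⁻ ν, fun y => ?_⟩
  rw [lap_schwartz, SchwartzMap.laplacian_eq_fourierMultiplierCLM,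
    SchwartzMap.fourierMultiplierCLM_apply, FourierTransform.fourier_fourierInv_eq]
  have ht : (fun x : EuclideanSpace ℝ (Fin n) => ‖x‖ ^ 2).HasTemperateGrowth := by fun_prop
  have : μ = -(2 * π) ^ 2 • SchwartzMap.smulLeftCLM ℂ (fun x : EuclideanSpace ℝ (Fin n) => ‖x‖ ^ 2) ν := by
    ext ξ
    rw [_root_.smul_apply, SchwartzMap.smulLeftCLM_apply_apply ht]
    change μ ξ = (-(2 * π) ^ 2) • (‖ξ‖ ^ 2) • (-((2 * π) ^ 2 * ‖ξ‖ ^ 2)⁻¹ : ℝ) • μ ξ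
    rw [smul_smul, smul_smul]
    by_cases h : μ ξ = 0
    · simp [h]
    · have h1 := (hμ ξ h).1
      have h2 : ‖ξ‖ ≠ 0 := by linarith
      have : (-(2 * π) ^ 2) * (‖ξ‖ ^ 2) * (-((2 * π) ^ 2 * ‖ξ‖ ^ 2)⁻¹ : ℝ) = 1 := by
        have := Real.pi_pos.ne'
        field_simp
      rw [this, one_smul]
  conv_rhs => rw [this]
  simp only [FourierTransform.fourierInv_smul]

theorem ker_scale {n : ℕ} {χ φ : 𝓢(EuclideanSpace ℝ (Fin n), ℝ)} (h : IsLPPair n χ φ)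
    (y : EuclideanSpace ℝ (Fin n)) :
    ((2:ℝ) ^ n) • ker χ ((2:ℝ) • y) = ker χ y + ker φ y := by
  have h1 : ker χ y + ker φ y = 𝓕⁻ (fun ξ => (χ ((2:ℝ)⁻¹ • ξ) : ℂ)) y := by
    have e : ker χ + ker φ = 𝓕⁻ (toC χ + toC φ) := by
      unfold ker; rw [FourierTransform.fourierInv_add]
    rw [← _root_.add_apply, e, SchwartzMap.fourierInv_coe]
    have hfun : (⇑(toC χ + toC φ)) = fun ξ => (χ ((2:ℝ)⁻¹ • ξ) : ℂ) := by
      ext ξ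
      rw [lp_half h, _root_.add_apply, toC_apply, toC_apply]; push_cast; rfl
    rw [hfun]
  rw [h1, ← ker_apply, Real.fourierInv_eq', Real.fourierInv_eq']
  have h2 := Measure.integral_comp_smul (volume : Measure (EuclideanSpace ℝ (Fin n)))
    (fun v => Complex.exp ((2 * π * inner ℝ v ((2:ℝ) • y) : ℝ) * Complex.I) • (χ v : ℂ)) (2:ℝ)⁻¹
  simp only [finrank_euclideanSpace, Fintype.card_fin] at h2
  rw [abs_of_pos (by positivity), inv_pow, inv_inv] at h2
  rw [← h2]
  congr 1
  ext v
  congr 4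
  rw [inner_smul_left, inner_smul_right]
  simp

theorem ker_integral {n : ℕ} {χ φ : 𝓢(EuclideanSpace ℝ (Fin n), ℝ)} (h : IsLPPair n χ φ) :
    ∫ y, ker χ y = 1 := by
  have h1 : 𝓕 (ker χ) = toC χ := by unfold ker; simp
  have h2 : (𝓕 (ker χ)) 0 = ∫ y, ker χ y := by
    rw [SchwartzMap.fourier_coe, Real.fourier_eq']
    simp
  rw [← h2, h1, toC_apply, lp_zero h]
  simp

theorem TT_half {n : ℕ} {χ φ : 𝓢(EuclideanSpace ℝ (Fin n), ℝ)} (h : IsLPPair n χ φ)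
    {u : EuclideanSpace ℝ (Fin n) → ℂ} (hu : Continuous u) {A : ℝ} (hA : ∀ x, ‖u x‖ ≤ A)
    (c : ℝ) (x : EuclideanSpace ℝ (Fin n)) :
    TT (ker χ) (c / 2) u x = TT (ker χ) c u x + TT (ker φ) c u x := by
  have hA0 : 0 ≤ A := (norm_nonneg _).trans (hA 0)
  have hi : ∀ k : 𝓢(EuclideanSpace ℝ (Fin n), ℂ), Integrable (fun y => k y * u (x - c • y)) :=
    fun k => integrable_growth k (hu.comp (by fun_prop)) (A := A) fun y => (hA _).trans (by
      nlinarith [norm_nonneg y])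
  unfold TT
  rw [← integral_add (hi _) (hi _)]
  have h2 := Measure.integral_comp_smul (volume : Measure (EuclideanSpace ℝ (Fin n)))
    (fun y => ker χ y * u (x - (c / 2) • y)) (2:ℝ)
  simp only [finrank_euclideanSpace, Fintype.card_fin] at h2
  rw [abs_of_pos (by positivity)] at h2
  have h3 : ∫ y, ker χ y * u (x - (c / 2) • y) = (2:ℝ) ^ n •
      ∫ y, ker χ ((2:ℝ) • y) * u (x - (c / 2) • (2:ℝ) • y) := by
    rw [h2, smul_smul, mul_inv_cancel₀ (by positivity), one_smul]
  rw [h3, ← integral_smul]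
  congr 1
  ext y
  rw [← add_mul, ← ker_scale h y, smul_mul_assoc, smul_smul]
  congr 4
  ring_nf

theorem TT_tendsto {n : ℕ} {χ φ : 𝓢(EuclideanSpace ℝ (Fin n), ℝ)} (h : IsLPPair n χ φ)
    {u : EuclideanSpace ℝ (Fin n) → ℂ} (hu : Continuous u) {A : ℝ} (hA : ∀ x, ‖u x‖ ≤ A)
    (x : EuclideanSpace ℝ (Fin n)) :
    Filter.Tendsto (fun M : ℕ => TT (ker χ) ((1/2:ℝ) ^ M) u x) Filter.atTop (nhds (u x)) := by
  have e : u x = ∫ y, ker χ y * u x := by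
    rw [integral_mul_const, ker_integral h, one_mul]
  rw [e]
  unfold TT
  refine tendsto_integral_of_dominated_convergence (fun y => ‖ker χ y‖ * A) ?_
    ((ker χ).integrable.norm.mul_const A) ?_ ?_
  · intro M
    exact ((ker χ).continuous.mul (hu.comp (by fun_prop))).aestronglyMeasurable
  · intro M
    refine Filter.Eventually.of_forall fun y => ?_
    rw [norm_mul]
    gcongr
    exact hA _
  · refine Filter.Eventually.of_forall fun y => ?_
    refine Filter.Tendsto.const_mul _ ?_
    have h1 : Filter.Tendsto (fun M : ℕ => x - ((1/2:ℝ) ^ M) • y) Filter.atTop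
        (nhds (x - (0:ℝ) • y)) :=
      tendsto_const_nhds.sub ((tendsto_pow_atTop_nhds_zero_of_lt_one
        (by norm_num) (by norm_num)).smul_const y)
    rw [zero_smul, sub_zero] at h1
    exact (hu.tendsto x).comp h1


theorem sum_split {a : ℕ → ℂ} {P q R : ℝ} (hq0 : 0 ≤ q) (hq1 : q < 1) (hR : 0 ≤ R)
    (h1 : ∀ j, ‖a j‖ ≤ P) (h2 : ∀ j, ‖a j‖ ≤ q ^ j * R) (N M : ℕ) :
    ‖∑ j ∈ Finset.range M, a j‖ ≤ N * P + q ^ N * ((1 - q)⁻¹ * R) := by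
  calc ‖∑ j ∈ Finset.range M, a j‖ ≤ ∑ j ∈ Finset.range M, ‖a j‖ := norm_sum_le _ _
    _ ≤ ∑ j ∈ Finset.range (N + M), ‖a j‖ :=
        Finset.sum_le_sum_of_subset_of_nonneg (by simp) fun _ _ _ => norm_nonneg _
    _ = ∑ j ∈ Finset.range N, ‖a j‖ + ∑ k ∈ Finset.range M, ‖a (N + k)‖ :=
        Finset.sum_range_add _ _ _
    _ ≤ ∑ j ∈ Finset.range N, P + ∑ k ∈ Finset.range M, q ^ N * (q ^ k * R) := by
        gcongr with j _ k _
        · exact h1 j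
        · refine (h2 _).trans_eq ?_
          rw [pow_add, mul_assoc]
    _ = N * P + q ^ N * ((∑ k ∈ Finset.range M, q ^ k) * R) := by
        rw [← Finset.mul_sum, ← Finset.sum_mul]; simp
    _ ≤ N * P + q ^ N * ((1 - q)⁻¹ * R) := by
        gcongr
        rw [← tsum_geometric_of_lt_one hq0 hq1]
        exact (summable_geometric_of_lt_one hq0 hq1).sum_le_tsum _ fun _ _ => by positivity

theorem lpBlock_neg_one {n : ℕ} (χ φ : 𝓢(EuclideanSpace ℝ (Fin n), ℝ))
    (f : EuclideanSpace ℝ (Fin n) → ℂ) : lpBlock n χ φ (-1) f = TT (ker χ) 1 f := by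
  ext x
  simp only [lpBlock, if_true, TT, ker_apply, one_smul]

theorem lpBlock_nat {n : ℕ} (χ φ : 𝓢(EuclideanSpace ℝ (Fin n), ℝ))
    (f : EuclideanSpace ℝ (Fin n) → ℂ) (j : ℕ) :
    lpBlock n χ φ j f = TT (ker φ) ((1/2:ℝ) ^ j) f := by
  ext x
  have h1 : (j : ℤ) ≠ -1 := by omega
  have h2 : (2:ℝ) ^ (-(j:ℤ)) = (1/2:ℝ) ^ j := by
    rw [zpow_neg, zpow_natCast, one_div, inv_pow]
  simp only [lpBlock, if_neg h1, if_pos (Int.natCast_nonneg j), TT, ker_apply, h2]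

theorem ae_of_besov {n : ℕ} {χ φ : 𝓢(EuclideanSpace ℝ (Fin n), ℝ)}
    {f : EuclideanSpace ℝ (Fin n) → ℂ} (hB : besovNorm n χ φ 1 ⊤ f ≠ ⊤) (j : ℤ) (hj : -1 ≤ j) :
    ∀ᵐ y, ‖lpBlock n χ φ j f y‖ ≤ (2:ℝ) ^ (-j) * (besovNorm n χ φ 1 ⊤ f).toReal := by
  have h1 : ENNReal.ofReal ((2:ℝ) ^ ((j : ℝ) * 1)) * eLpNorm (lpBlock n χ φ j f) ⊤ volume
      ≤ besovNorm n χ φ 1 ⊤ f := by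
    unfold besovNorm
    exact le_iSup₂ (f := fun (j : ℤ) (_ : -1 ≤ j) =>
      ENNReal.ofReal ((2:ℝ) ^ ((j : ℝ) * 1)) * eLpNorm (lpBlock n χ φ j f) ⊤ volume) j hj
  rw [eLpNorm_exponent_top, mul_one, Real.rpow_intCast] at h1
  filter_upwards [enorm_ae_le_eLpNormEssSup (lpBlock n χ φ j f) volume] with y hy
  have h2 : ENNReal.ofReal ((2:ℝ) ^ j) * ‖lpBlock n χ φ j f y‖ₑ ≤ besovNorm n χ φ 1 ⊤ f :=
    le_trans (by gcongr) h1
  have h3 := ENNReal.toReal_mono hB h2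
  rw [ENNReal.toReal_mul, ENNReal.toReal_ofReal (by positivity), toReal_enorm] at h3
  rw [zpow_neg, inv_mul_eq_div, le_div_iff₀ (by positivity)]
  linarith

theorem fderiv_le_of_top {n : ℕ} {f : EuclideanSpace ℝ (Fin n) → ℂ} (hf : ContDiff ℝ 3 f)
    (hA : eLpNorm (fderiv ℝ f) ⊤ volume ≠ ⊤) (y : EuclideanSpace ℝ (Fin n)) :
    ‖fderiv ℝ f y‖ ≤ (eLpNorm (fderiv ℝ f) ⊤ volume).toReal := by
  have hc : Continuous (fderiv ℝ f) := hf.continuous_fderiv (by norm_num)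
  have h1 : ∀ᵐ y, ‖fderiv ℝ f y‖ ≤ (eLpNorm (fderiv ℝ f) ⊤ volume).toReal := by
    filter_upwards [enorm_ae_le_eLpNormEssSup (fderiv ℝ f) volume] with y hy
    rw [← eLpNorm_exponent_top] at hy
    have := ENNReal.toReal_mono hA hy
    rwa [toReal_enorm] at this
  have h2 := Measure.dense_of_ae h1
  have h3 : IsClosed {y | ‖fderiv ℝ f y‖ ≤ (eLpNorm (fderiv ℝ f) ⊤ volume).toReal} :=
    isClosed_le hc.norm continuous_const
  have h4 := h2.closure_eq
  rw [h3.closure_eq] at h4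
  have : y ∈ (Set.univ : Set (EuclideanSpace ℝ (Fin n))) := Set.mem_univ y
  rw [← h4] at this
  exact this

/-- The geometric ratio. -/
def qq : ℝ := (1/2:ℝ) ^ (1/2:ℝ)

theorem qq_nonneg : 0 ≤ qq := by unfold qq; positivity

theorem qq_lt : qq < 1 := Real.rpow_lt_one (by norm_num) (by norm_num) (by norm_num)

theorem TT_telescope {n : ℕ} {χ φ : 𝓢(EuclideanSpace ℝ (Fin n), ℝ)} (h : IsLPPair n χ φ)
    {u : EuclideanSpace ℝ (Fin n) → ℂ} (hu : Continuous u) {A : ℝ} (hA : ∀ x, ‖u x‖ ≤ A)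
    (x : EuclideanSpace ℝ (Fin n)) (M : ℕ) :
    TT (ker χ) ((1/2:ℝ) ^ M) u x = TT (ker χ) 1 u x +
      ∑ j ∈ Finset.range M, TT (ker φ) ((1/2:ℝ) ^ j) u x := by
  induction M with
  | zero => simp
  | succ M ih =>
    rw [Finset.sum_range_succ, ← add_assoc, ← ih, ← TT_half h hu hA]
    congr 1
    ring

theorem dir_est (n : ℕ) (hn : n = 2 ∨ n = 3) (χ φ : 𝓢(EuclideanSpace ℝ (Fin n), ℝ))
    (h : IsLPPair n χ φ) (i : Fin n) :
    ∃ C : ℝ, 0 ≤ C ∧ ∀ f : EuclideanSpace ℝ (Fin n) → ℂ, ContDiff ℝ 3 f →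
      eLpNorm (fderiv ℝ f) ⊤ volume ≠ ⊤ → besovNorm n χ φ 1 ⊤ f ≠ ⊤ →
      eLpNorm (fderiv ℝ (lap n f)) 2 volume ≠ ⊤ → ∀ (N : ℕ) (x : EuclideanSpace ℝ (Fin n)),
      ‖fderiv ℝ f x (EuclideanSpace.single i 1)‖ ≤ C * ((N + 1) * (besovNorm n χ φ 1 ⊤ f).toReal +
        qq ^ N * (eLpNorm (fderiv ℝ (lap n f)) 2 volume).toReal) := by
  set v : EuclideanSpace ℝ (Fin n) := EuclideanSpace.single i 1 with hv
  have hv1 : ‖v‖ = 1 := by simp [hv]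
  have hχs : ∀ ξ, toC χ ξ ≠ 0 → ‖ξ‖ ≤ 8/3 := by
    intro ξ hξ
    have h1 : χ ξ ≠ 0 := fun h0 => hξ (by rw [toC_apply, h0]; simp)
    have h2 := h.2.2.2.2.1 (subset_tsupport _ h1)
    rw [mem_closedBall_zero_iff] at h2
    linarith
  have hφs : ∀ ξ, toC φ ξ ≠ 0 → 3/4 ≤ ‖ξ‖ ∧ ‖ξ‖ ≤ 8/3 := by
    intro ξ hξ
    have h1 : φ ξ ≠ 0 := fun h0 => hξ (by rw [toC_apply, h0]; simp)
    exact h.2.2.2.2.2.1 (subset_tsupport _ h1)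
  obtain ⟨K₁, k₁, hk₁, hK₁⟩ := exists_bernstein_kernel v (toC χ) hχs
  obtain ⟨K₂, k₂, hk₂, hK₂⟩ := exists_bernstein_kernel v (toC φ) fun ξ hξ => (hφs ξ hξ).2
  obtain ⟨m, hm⟩ := exists_inv_lap (toC φ) hφs
  have hm' : lap n m = ker φ := funext hm
  set a₁ := ∫ z, ‖K₁ z‖
  set a₂ := ∫ z, ‖K₂ z‖
  have ha₁ : 0 ≤ a₁ := integral_nonneg fun _ => norm_nonneg _
  have ha₂ : 0 ≤ a₂ := integral_nonneg fun _ => norm_nonneg _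
  set G := (eLpNorm m 2 volume).toReal
  have hG : 0 ≤ G := ENNReal.toReal_nonneg
  have hq : 0 ≤ (1 - qq)⁻¹ := inv_nonneg.2 (by linarith [qq_lt])
  refine ⟨2 * a₁ + a₂ + (1 - qq)⁻¹ * G, by positivity, fun f hf hA hB hD N x => ?_⟩
  have hL := fderiv_le_of_top hf hA
  set L := (eLpNorm (fderiv ℝ f) ⊤ volume).toReal
  have hBes := ae_of_besov hB
  set B := (besovNorm n χ φ 1 ⊤ f).toReal
  have hB0 : 0 ≤ B := ENNReal.toReal_nonneg
  have hf1 : ContDiff ℝ 1 f := hf.of_le (by norm_num)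
  have hu2 : ContDiff ℝ 2 (dd v f) := dd_contDiff (k := 2) v (by exact_mod_cast hf)
  have huA : ∀ x, ‖dd v f x‖ ≤ L := fun x => by
    refine ((fderiv ℝ f x).le_opNorm v).trans ?_
    rw [hv1, mul_one]; exact hL x
  have hle : eLpNorm (lap n (dd v f)) 2 volume ≤ eLpNorm (fderiv ℝ (lap n f)) 2 volume := by
    rw [lap_dd v hf]
    refine eLpNorm_mono fun x => ?_
    refine ((fderiv ℝ (lap n f) x).le_opNorm v).trans ?_
    rw [hv1, mul_one]
  have hleR := ENNReal.toReal_mono hD hle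
  set D := (eLpNorm (fderiv ℝ (lap n f)) 2 volume).toReal
  have hD0 : 0 ≤ D := ENNReal.toReal_nonneg
  have hl : ‖TT (ker χ) 1 (dd v f) x‖ ≤ 2 * a₁ * B := by
    have h1 := hBes (-1) le_rfl
    rw [lpBlock_neg_one] at h1
    have := bernstein_est v (ker χ) K₁ k₁ hk₁ hK₁ hf1 hL one_pos h1 x
    refine this.trans_eq ?_
    simp only [neg_neg, zpow_one, inv_one, a₁]
    ring
  have hlow : ∀ j : ℕ, ‖TT (ker φ) ((1/2:ℝ) ^ j) (dd v f) x‖ ≤ a₂ * B := by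
    intro j
    have h1 := hBes j (by omega)
    rw [lpBlock_nat] at h1
    have := bernstein_est v (ker φ) K₂ k₂ hk₂ hK₂ hf1 hL (c := (1/2:ℝ) ^ j) (by positivity) h1 x
    refine this.trans_eq ?_
    rw [zpow_neg, zpow_natCast, one_div, inv_pow, inv_inv]
    have : (2:ℝ) ^ j ≠ 0 := by positivity
    field_simp
    simp only [a₂]
    ring
  have hhigh : ∀ j : ℕ, ‖TT (ker φ) ((1/2:ℝ) ^ j) (dd v f) x‖ ≤ qq ^ j * (G * D) := by
    intro j
    have := high_est m hu2 L huA (ne_top_of_le_ne_top hD hle) (c := (1/2:ℝ) ^ j) (by positivity) x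
    rw [hm'] at this
    refine this.trans ?_
    have hp : ((1/2:ℝ) ^ j) ^ (2 - (n:ℝ)/2) ≤ qq ^ j := by
      unfold qq
      rw [← Real.rpow_natCast, ← Real.rpow_natCast, ← Real.rpow_mul (by norm_num),
        ← Real.rpow_mul (by norm_num), mul_comm]
      refine Real.rpow_le_rpow_of_exponent_ge (by norm_num) (by norm_num) ?_
      refine mul_le_mul_of_nonneg_right ?_ (Nat.cast_nonneg j)
      rcases hn with rfl | rfl <;> norm_num
    have := pow_nonneg qq_nonneg j
    gcongr
  have hsum := sum_split qq_nonneg qq_lt (mul_nonneg hG hD0) hlow hhigh N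
  have hM : ∀ M : ℕ, ‖TT (ker χ) ((1/2:ℝ) ^ M) (dd v f) x‖ ≤
      2 * a₁ * B + (N * (a₂ * B) + qq ^ N * ((1 - qq)⁻¹ * (G * D))) := by
    intro M
    rw [TT_telescope h hu2.continuous huA]
    exact (norm_add_le _ _).trans (add_le_add hl (hsum M))
  have hlim := le_of_tendsto (TT_tendsto h hu2.continuous huA x).norm
    (Filter.Eventually.of_forall hM)
  refine hlim.trans ?_
  have hN : (0:ℝ) ≤ N := Nat.cast_nonneg N
  have hqN : 0 ≤ qq ^ N := pow_nonneg qq_nonneg N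
  have e1 : 0 ≤ 2 * a₁ * (N * B) := by positivity
  have e2 : 0 ≤ a₂ * B := by positivity
  have e3 : 0 ≤ (1 - qq)⁻¹ * G * ((N + 1) * B) := by positivity
  have e4 : 0 ≤ (2 * a₁ + a₂) * (qq ^ N * D) := by positivity
  linarith

theorem norm_le_sum {n : ℕ} (T : EuclideanSpace ℝ (Fin n) →L[ℝ] ℂ) :
    ‖T‖ ≤ ∑ i, ‖T (EuclideanSpace.single i 1)‖ := by
  refine T.opNorm_le_bound (Finset.sum_nonneg fun _ _ => norm_nonneg _) fun x => ?_
  have hx : x = ∑ i, x i • EuclideanSpace.single i (1:ℝ) := by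
    have := (EuclideanSpace.basisFun (Fin n) ℝ).sum_repr x
    simpa using this.symm
  calc ‖T x‖ = ‖∑ i, x i • T (EuclideanSpace.single i 1)‖ := by
        conv_lhs => rw [hx]
        simp only [map_sum, map_smul]
    _ ≤ ∑ i, ‖x i • T (EuclideanSpace.single i 1)‖ := norm_sum_le _ _
    _ ≤ ∑ i, ‖T (EuclideanSpace.single i 1)‖ * ‖x‖ := by
        gcongr with i
        rw [norm_smul, mul_comm]
        gcongr
        exact PiLp.norm_apply_le x i
    _ = _ := by rw [Finset.sum_mul]

theorem space_est (n : ℕ) (hn : n = 2 ∨ n = 3) (χ φ : 𝓢(EuclideanSpace ℝ (Fin n), ℝ))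
    (h : IsLPPair n χ φ) :
    ∃ C : ℝ, 0 ≤ C ∧ ∀ f : EuclideanSpace ℝ (Fin n) → ℂ, ContDiff ℝ 3 f →
      eLpNorm (fderiv ℝ f) ⊤ volume ≠ ⊤ → besovNorm n χ φ 1 ⊤ f ≠ ⊤ →
      eLpNorm (fderiv ℝ (lap n f)) 2 volume ≠ ⊤ → ∀ (N : ℕ),
      (eLpNorm (fderiv ℝ f) ⊤ volume).toReal ≤ C * ((N + 1) * (besovNorm n χ φ 1 ⊤ f).toReal +
        qq ^ N * (eLpNorm (fderiv ℝ (lap n f)) 2 volume).toReal) := by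
  choose C hC0 hC using dir_est n hn χ φ h
  refine ⟨∑ i, C i, Finset.sum_nonneg fun i _ => hC0 i, fun f hf hA hB hD N => ?_⟩
  have hqN : 0 ≤ qq ^ N := pow_nonneg qq_nonneg N
  have hpos : 0 ≤ (∑ i, C i) * ((N + 1) * (besovNorm n χ φ 1 ⊤ f).toReal +
        qq ^ N * (eLpNorm (fderiv ℝ (lap n f)) 2 volume).toReal) :=
    mul_nonneg (Finset.sum_nonneg fun i _ => hC0 i) (by positivity)
  refine ENNReal.toReal_le_of_le_ofReal hpos ?_
  rw [eLpNorm_exponent_top]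
  refine eLpNormEssSup_le_of_ae_bound (Filter.Eventually.of_forall fun x => ?_)
  refine (norm_le_sum _).trans ?_
  rw [Finset.sum_mul]
  exact Finset.sum_le_sum fun i _ => hC i f hf hA hB hD N x

theorem choose_N {δ : ℝ} (hδ : 0 ≤ δ) : ∃ N : ℕ, qq ^ N * δ ≤ 1 ∧
    (N + 1 : ℝ) ≤ (2 / Real.log 2 + 2) * Real.log (δ + Real.exp 1) := by
  set l := Real.log (δ + Real.exp 1) with hl
  have hpos : 0 < δ + Real.exp 1 := by positivity
  have hl1 : 1 ≤ l := by
    rw [hl, Real.le_log_iff_exp_le hpos]; linarith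
  have h2 : 0 < Real.log 2 := Real.log_pos (by norm_num)
  refine ⟨⌈2 * l / Real.log 2⌉₊, ?_, ?_⟩
  · set N := ⌈2 * l / Real.log 2⌉₊
    have hN : 2 * l / Real.log 2 ≤ N := Nat.le_ceil _
    have h3 : qq ^ N ≤ (δ + Real.exp 1)⁻¹ := by
      unfold qq
      rw [← Real.rpow_natCast, ← Real.rpow_mul (by norm_num), ← Real.exp_log hpos, ← hl,
        ← Real.exp_neg, Real.rpow_def_of_pos (by norm_num), Real.exp_le_exp, one_div,
        Real.log_inv]
      rw [div_le_iff₀ h2] at hN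
      linarith
    calc qq ^ N * δ ≤ (δ + Real.exp 1)⁻¹ * (δ + Real.exp 1) := by
          gcongr
          linarith [Real.exp_pos 1]
      _ = 1 := inv_mul_cancel₀ hpos.ne'
  · have h3 := Nat.ceil_lt_add_one (a := 2 * l / Real.log 2) (by positivity)
    have h4 : (2 / Real.log 2 + 2) * l = 2 * l / Real.log 2 + 2 * l := by ring
    linarith

/-- **Logarithmic inequality (Lemma 2.4).** For `n ∈ {2,3}` there is `C = C(n)` such that for
all `t₁ < t₂` and all time-dependent `f` with the quantities below defined and finite,
`∫_{t₁}^{t₂} ‖∇f‖_∞ dt ≤ C [(∫_{t₁}^{t₂} ‖f‖_{B¹_{∞,∞}} dt) log(∫_{t₁}^{t₂} ‖∇Δf‖_{L²} dt + e) + 1]`. -/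
theorem log_interpolation_time (n : ℕ) (hn : n = 2 ∨ n = 3)
    (χ φ : 𝓢(EuclideanSpace ℝ (Fin n), ℝ)) (hχφ : IsLPPair n χ φ) :
    ∃ C : ℝ, 0 < C ∧
      ∀ (t₁ t₂ : ℝ), t₁ < t₂ →
        ∀ f : ℝ → EuclideanSpace ℝ (Fin n) → ℂ,
          (∀ t ∈ Set.Icc t₁ t₂, ContDiff ℝ 3 (f t)) →
          (∀ t ∈ Set.Icc t₁ t₂, eLpNorm (fderiv ℝ (f t)) ⊤ volume ≠ ⊤) →
          (∀ t ∈ Set.Icc t₁ t₂, besovNorm n χ φ 1 ⊤ (f t) ≠ ⊤) →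
          (∀ t ∈ Set.Icc t₁ t₂, eLpNorm (fderiv ℝ (lap n (f t))) 2 volume ≠ ⊤) →
          IntegrableOn (fun t => (eLpNorm (fderiv ℝ (f t)) ⊤ volume).toReal) (Set.Icc t₁ t₂) →
          IntegrableOn (fun t => (besovNorm n χ φ 1 ⊤ (f t)).toReal) (Set.Icc t₁ t₂) →
          IntegrableOn (fun t => (eLpNorm (fderiv ℝ (lap n (f t))) 2 volume).toReal)
            (Set.Icc t₁ t₂) →
          ∫ t in t₁..t₂, (eLpNorm (fderiv ℝ (f t)) ⊤ volume).toReal ≤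
            C * ((∫ t in t₁..t₂, (besovNorm n χ φ 1 ⊤ (f t)).toReal) *
                Real.log
                  ((∫ t in t₁..t₂, (eLpNorm (fderiv ℝ (lap n (f t))) 2 volume).toReal) +
                    Real.exp 1) + 1) := by
  obtain ⟨C, hC0, hC⟩ := space_est n hn χ φ hχφ
  have h2 : 0 < Real.log 2 := Real.log_pos (by norm_num)
  set k := 2 / Real.log 2 + 2 with hk
  have hk1 : 1 ≤ k := by
    have : 0 < 2 / Real.log 2 := by positivity
    linarith
  refine ⟨C * k + 1, by positivity, fun t₁ t₂ ht f hf hA hB hD iA iB iD => ?_⟩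
  have jA := (intervalIntegrable_iff_integrableOn_Icc_of_le ht.le).2 iA
  have jB := (intervalIntegrable_iff_integrableOn_Icc_of_le ht.le).2 iB
  have jD := (intervalIntegrable_iff_integrableOn_Icc_of_le ht.le).2 iD
  have hβ : 0 ≤ ∫ t in t₁..t₂, (besovNorm n χ φ 1 ⊤ (f t)).toReal :=
    intervalIntegral.integral_nonneg ht.le fun _ _ => ENNReal.toReal_nonneg
  have hδ : 0 ≤ ∫ t in t₁..t₂, (eLpNorm (fderiv ℝ (lap n (f t))) 2 volume).toReal :=
    intervalIntegral.integral_nonneg ht.le fun _ _ => ENNReal.toReal_nonneg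
  obtain ⟨N, hN1, hN2⟩ := choose_N hδ
  have hint : ∫ t in t₁..t₂, (eLpNorm (fderiv ℝ (f t)) ⊤ volume).toReal ≤
      ∫ t in t₁..t₂, C * ((N + 1) * (besovNorm n χ φ 1 ⊤ (f t)).toReal +
        qq ^ N * (eLpNorm (fderiv ℝ (lap n (f t))) 2 volume).toReal) :=
    intervalIntegral.integral_mono_on ht.le jA
      (((jB.const_mul _).add (jD.const_mul _)).const_mul _)
      fun t htt => hC (f t) (hf t htt) (hA t htt) (hB t htt) (hD t htt) N
  rw [intervalIntegral.integral_const_mul,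
    intervalIntegral.integral_add (jB.const_mul _) (jD.const_mul _),
    intervalIntegral.integral_const_mul, intervalIntegral.integral_const_mul] at hint
  set β := ∫ t in t₁..t₂, (besovNorm n χ φ 1 ⊤ (f t)).toReal
  set δ := ∫ t in t₁..t₂, (eLpNorm (fderiv ℝ (lap n (f t))) 2 volume).toReal
  rw [← hk] at hN2
  set l := Real.log (δ + Real.exp 1)
  have hkl : 0 ≤ k * l := le_trans (by positivity) hN2
  have hl : 0 ≤ l := by
    by_contra hneg
    push Not at hneg
    nlinarith
  calc _ ≤ C * ((N + 1) * β + qq ^ N * δ) := hint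
    _ ≤ C * (k * l * β + k * 1) := by
        refine mul_le_mul_of_nonneg_left (add_le_add ?_ (by linarith)) hC0
        exact mul_le_mul_of_nonneg_right hN2 hβ
    _ = C * k * (β * l + 1) := by ring
    _ ≤ (C * k + 1) * (β * l + 1) := by
        gcongr
        linarith
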